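/- Let t ≥ 2 be an integer and let ε > 0, c ≥ 1, B ≥ 1, K' ≥ 1 be reals. There exists a threshold s₀ > 0 (depending on t, ε, c) such that the following holds for every real s ≥ s₀ and every real L ≥ 1. Suppose K : ℕ × ℕ → ℝ≥0 satisfies: (base case) K(m,n) ≤ B·(m+n) whenever m ≤ L and n ≤ L; (primal recurrence) whenever m > L and m ≥ n, there exist reals s₁,…,s_t with s ≤ s_i ≤ s^{K'} for each i, positive integers ξ₁,…,ξ_t, and natural numbers p_{ij}, q_{ij} (for 1 ≤ i ≤ t, 1 ≤ j ≤ ξ_i) with p_{ij} ≤ m/s_i and q_{ij} ≤ n for all i,j, with Σ_{i=1}^{t} Σ_{j=1}^{ξ_i} p_{ij} ≤ m, and with Σ_{j=1}^{ξ_i} q_{ij} ≤ c·n·s_i^{1−1/t} for each i, such that K(m,n) ≤ B·(m+n) + Σ_{i=1}^{t} Σ_{j=1}^{ξ_i} K(p_{ij}, q_{ij}); and (dual recurrence) the symmetric condition with the roles of the two arguments exchanged whenever n > L and n ≥ m. Then there is a constant A (depending only on t, ε, s, c, B, K') such that for all natural numbers m, n: K(m,n) ≤ A·( m^{t/(t+1)+ε}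 · n^{t/(t+1)+ε} / L^{(t−1)/(t+1)} + m^{1+ε} + n^{1+ε} ). -/

import Mathlib

open Finset

/-- The Hölder inequality in the form `∑ a^(1-α) b^α ≤ (∑ a)^(1-α) (∑ b)^α`. -/
lemma sum_rpow_mul_rpow_le {ι : Type*} (S : Finset ι) (a b : ι → ℝ) (ha : ∀ j, 0 ≤ a j)
    (hb : ∀ j, 0 ≤ b j) {α : ℝ} (h0 : 0 < α) (h1 : α < 1) :
    ∑ j ∈ S, a j ^ (1 - α) * b j ^ α ≤ (∑ j ∈ S, a j) ^ (1 - α) * (∑ j ∈ S, b j) ^ α := by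
  have h1' : 0 < 1 - α := by linarith
  have hpq : (1 / (1 - α)).HolderConjugate (1 / α) := by
    rw [Real.holderConjugate_iff]
    refine ⟨by rw [lt_div_iff₀ h1']; linarith, by simp⟩
  have h := Real.inner_le_Lp_mul_Lq_of_nonneg S hpq (f := fun j => a j ^ (1 - α))
    (g := fun j => b j ^ α) (fun j _ => Real.rpow_nonneg (ha j) _)
    (fun j _ => Real.rpow_nonneg (hb j) _)
  have ea : ∀ j, (a j ^ (1 - α)) ^ (1 / (1 - α)) = a j := fun j => by
    rw [← Real.rpow_mul (ha j), mul_one_div_cancel h1'.ne', Real.rpow_one]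
  have eb : ∀ j, (b j ^ α) ^ (1 / α) = b j := fun j => by
    rw [← Real.rpow_mul (hb j), mul_one_div_cancel h0.ne', Real.rpow_one]
  simp_rw [ea, eb, one_div_one_div] at h
  exact h

/-- One round of partitioning shrinks the mixed term by the factor `c σ^(-ε)`. -/
lemma sum_mixed_le {ι : Type*} (S : Finset ι) (a b : ι → ℝ) {m n σ c α β ε : ℝ}
    (ha : ∀ j, 0 ≤ a j) (hb : ∀ j, 0 ≤ b j) (hm : 0 ≤ m) (hn : 0 ≤ n) (hσ : 0 < σ)
    (hc : 1 ≤ c) (hε : 0 < ε) (h0 : 1 / 2 ≤ α) (h1 : α < 1) (hβ : β * α = 2 * α - 1)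
    (ham : ∀ j, a j ≤ m / σ) (hbn : ∀ j, b j ≤ n) (hsa : ∑ j ∈ S, a j ≤ m)
    (hsb : ∑ j ∈ S, b j ≤ c * n * σ ^ β) :
    ∑ j ∈ S, a j ^ (α + ε) * b j ^ (α + ε)
      ≤ c * σ ^ (-ε) * (m ^ (α + ε) * n ^ (α + ε)) := by
  have hα : 0 < α := by linarith
  have hpoint : ∀ j, a j ^ (α + ε) * b j ^ (α + ε)
      ≤ ((m / σ) ^ (2 * α - 1 + ε) * n ^ ε) * (a j ^ (1 - α) * b j ^ α) := fun j => by
    have e1 : a j ^ (α + ε) = a j ^ (2 * α - 1 + ε) * a j ^ (1 - α) := by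
      rw [← Real.rpow_add_of_nonneg (ha j) (by linarith) (by linarith)]; ring_nf
    have e2 : b j ^ (α + ε) = b j ^ ε * b j ^ α := by
      rw [← Real.rpow_add_of_nonneg (hb j) hε.le hα.le]; ring_nf
    have l1 : a j ^ (2 * α - 1 + ε) ≤ (m / σ) ^ (2 * α - 1 + ε) :=
      Real.rpow_le_rpow (ha j) (ham j) (by linarith)
    have l2 : b j ^ ε ≤ n ^ ε := Real.rpow_le_rpow (hb j) (hbn j) hε.le
    have := ha j
    have := hb j
    calc a j ^ (α + ε) * b j ^ (α + ε)
        = (a j ^ (2 * α - 1 + ε) * b j ^ ε) * (a j ^ (1 - α) * b j ^ α) := by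
          rw [e1, e2]; ring
      _ ≤ _ := by gcongr
  have hsa0 : 0 ≤ ∑ j ∈ S, a j := sum_nonneg fun j _ => ha j
  have hsb0 : 0 ≤ ∑ j ∈ S, b j := sum_nonneg fun j _ => hb j
  have hcα : c ^ α ≤ c := by
    simpa using Real.rpow_le_rpow_of_exponent_le hc h1.le
  have hsplit : (c * n * σ ^ β) ^ α = c ^ α * n ^ α * σ ^ (2 * α - 1) := by
    rw [Real.mul_rpow (by positivity) (by positivity), Real.mul_rpow (by positivity) hn,
      ← Real.rpow_mul hσ.le, hβ]
  have em : m ^ (α + ε) = m ^ (2 * α - 1 + ε) * m ^ (1 - α) := by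
    rw [← Real.rpow_add_of_nonneg hm (by linarith) (by linarith)]; ring_nf
  have en : n ^ (α + ε) = n ^ ε * n ^ α := by
    rw [← Real.rpow_add_of_nonneg hn hε.le hα.le]; ring_nf
  have eσ : σ ^ (2 * α - 1) / σ ^ (2 * α - 1 + ε) = σ ^ (-ε) := by
    rw [← Real.rpow_sub hσ]; ring_nf
  calc ∑ j ∈ S, a j ^ (α + ε) * b j ^ (α + ε)
      ≤ ((m / σ) ^ (2 * α - 1 + ε) * n ^ ε) * ∑ j ∈ S, a j ^ (1 - α) * b j ^ α := by
        rw [mul_sum]; exact sum_le_sum fun j _ => hpoint j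
    _ ≤ ((m / σ) ^ (2 * α - 1 + ε) * n ^ ε)
          * ((∑ j ∈ S, a j) ^ (1 - α) * (∑ j ∈ S, b j) ^ α) := by
        gcongr; exact sum_rpow_mul_rpow_le S a b ha hb hα h1
    _ ≤ ((m / σ) ^ (2 * α - 1 + ε) * n ^ ε) * (m ^ (1 - α) * (c * n * σ ^ β) ^ α) := by
        have : 0 ≤ 1 - α := by linarith
        gcongr
    _ = c ^ α * σ ^ (-ε) * (m ^ (α + ε) * n ^ (α + ε)) := by
        rw [hsplit, em, en, ← eσ, Real.div_rpow hm hσ.le]; ring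
    _ ≤ _ := by gcongr

/-- If every `a j` is at most `M`, then `∑ a^(1+ε) ≤ M^ε ∑ a`. -/
lemma sum_rpow_one_add_le {ι : Type*} (S : Finset ι) (a : ι → ℝ) {M ε : ℝ}
    (ha : ∀ j, 0 ≤ a j) (hε : 0 < ε) (haM : ∀ j, a j ≤ M) :
    ∑ j ∈ S, a j ^ (1 + ε) ≤ M ^ ε * ∑ j ∈ S, a j := by
  rw [mul_sum]
  refine sum_le_sum fun j _ => ?_
  rw [Real.rpow_add_of_nonneg (ha j) zero_le_one hε.le, Real.rpow_one, mul_comm]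
  have := ha j
  have := haM j
  gcongr

/-- The shape of the bound: `m^(α+ε) n^(α+ε) / L^γ + m^(1+ε) + n^(1+ε)`. -/
noncomputable def growthBound (α γ ε L m n : ℝ) : ℝ :=
  m ^ (α + ε) * n ^ (α + ε) / L ^ γ + m ^ (1 + ε) + n ^ (1 + ε)

lemma growthBound_comm (α γ ε L m n : ℝ) :
    growthBound α γ ε L m n = growthBound α γ ε L n m := by
  unfold growthBound; ring

lemma add_le_growthBound {α γ ε L : ℝ} (hε : 0 < ε) (hL : 1 ≤ L) (m n : ℕ) :
    (m : ℝ) + n ≤ growthBound α γ ε L m n := by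
  have h : ∀ k : ℕ, (k : ℝ) ≤ (k : ℝ) ^ (1 + ε) := fun k => by
    rcases Nat.eq_zero_or_pos k with rfl | hk
    · simpa using Real.rpow_nonneg le_rfl _
    · have : (1 : ℝ) ≤ k := by exact_mod_cast hk
      simpa using Real.rpow_le_rpow_of_exponent_le this (by linarith : (1 : ℝ) ≤ 1 + ε)
  have h3 : 0 ≤ (m : ℝ) ^ (α + ε) * (n : ℝ) ^ (α + ε) / L ^ γ := by positivity
  unfold growthBound
  linarith [h m, h n]

/-- The side conditions on one application of the partitioning theorem to `m` points and
`n` ranges. -/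
structure IsPartitioning {t : ℕ} (s c K' : ℝ) (m n : ℕ) (si : Fin t → ℝ) (ξ : Fin t → ℕ)
    (p q : (i : Fin t) → Fin (ξ i) → ℕ) : Prop where
  le_si : ∀ i, s ≤ si i
  si_le : ∀ i, si i ≤ s ^ K'
  p_le : ∀ i j, (p i j : ℝ) ≤ (m : ℝ) / si i
  q_le : ∀ i j, q i j ≤ n
  sum_p : ∑ i, ∑ j, (p i j : ℝ) ≤ m
  sum_q : ∀ i, ∑ j, (q i j : ℝ) ≤ c * (n : ℝ) * si i ^ (1 - 1 / (t : ℝ))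

namespace IsPartitioning

variable {t : ℕ} {s c K' : ℝ} {m n : ℕ} {si : Fin t → ℝ} {ξ : Fin t → ℕ}
  {p q : (i : Fin t) → Fin (ξ i) → ℕ}

lemma add_lt (h : IsPartitioning s c K' m n si ξ p q) (hs : 1 < s) (hm : 0 < m)
    (i : Fin t) (j : Fin (ξ i)) : p i j + q i j < m + n := by
  have hm' : (0 : ℝ) < m := by exact_mod_cast hm
  have h1 : (p i j : ℝ) < m :=
    (h.p_le i j).trans_lt (div_lt_self hm' (hs.trans_le (h.le_si i)))
  have h2 : p i j < m := by exact_mod_cast h1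
  have := h.q_le i j
  omega

lemma sum_q_le (h : IsPartitioning s c K' m n si ξ p q) (ht : 1 ≤ t) (hc : 1 ≤ c)
    (hs : 1 < s) : ∑ i, ∑ j, (q i j : ℝ) ≤ t * c * s ^ K' * n := by
  have hi : ∀ i, ∑ j, (q i j : ℝ) ≤ c * n * s ^ K' := fun i => by
    have h1 : 1 ≤ si i := hs.le.trans (h.le_si i)
    have h2 : si i ^ (1 - 1 / (t : ℝ)) ≤ si i := by
      have : (0 : ℝ) ≤ 1 / t := by positivity
      simpa using Real.rpow_le_rpow_of_exponent_le h1 (by linarith : 1 - 1 / (t : ℝ) ≤ 1)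
    have h3 := h2.trans (h.si_le i)
    exact (h.sum_q i).trans (by gcongr)
  refine (sum_le_sum fun i _ => hi i).trans (le_of_eq ?_)
  simp
  ring

/-- One step of the induction giving a crude exponential bound. -/
lemma crude_step (h : IsPartitioning s c K' m n si ξ p q) (ht : 1 ≤ t) (hc : 1 ≤ c)
    (hs : 1 < s) (hm : 0 < m) {B G D x : ℝ} (hB : 1 ≤ B) (hG : G = t * c * s ^ K')
    (hG1 : 1 ≤ G) (hD : D = B + G) (k : (i : Fin t) → Fin (ξ i) → ℝ)
    (hk : ∀ i j, k i j ≤ D ^ (p i j + q i j) * ((p i j : ℝ) + q i j))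
    (hx : x ≤ B * ((m : ℝ) + n) + ∑ i, ∑ j, k i j) :
    x ≤ D ^ (m + n) * ((m : ℝ) + n) := by
  have hD1 : 1 ≤ D := by linarith
  obtain ⟨N, hN⟩ : ∃ N, m + n = N + 1 := ⟨m + n - 1, by omega⟩
  have h1 : ∑ i, ∑ j, k i j ≤ D ^ N * ∑ i, ∑ j, ((p i j : ℝ) + q i j) := by
    simp_rw [mul_sum]
    refine sum_le_sum fun i _ => sum_le_sum fun j _ => (hk i j).trans ?_
    have := h.add_lt hs hm i j
    have : p i j + q i j ≤ N := by omega
    gcongr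
  have h2 : ∑ i, ∑ j, ((p i j : ℝ) + q i j) ≤ G * ((m : ℝ) + n) := by
    simp_rw [sum_add_distrib]
    have := h.sum_q_le ht hc hs
    have := h.sum_p
    have hm0 : (0 : ℝ) ≤ m := by positivity
    rw [← hG] at *
    nlinarith
  have h3 : 1 ≤ D ^ N := one_le_pow₀ hD1
  have hmn : (0 : ℝ) ≤ (m : ℝ) + n := by positivity
  calc x ≤ B * ((m : ℝ) + n) + D ^ N * (G * ((m : ℝ) + n)) := by
        refine hx.trans (add_le_add le_rfl (h1.trans ?_)); gcongr
    _ ≤ D ^ N * (B * ((m : ℝ) + n)) + D ^ N * (G * ((m : ℝ) + n)) := by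
        exact add_le_add (le_mul_of_one_le_left (by positivity) h3) le_rfl
    _ = D ^ (m + n) * ((m : ℝ) + n) := by rw [hN, hD]; ring

/-- The inductive step for the main bound, valid once `m^ε` is large. -/
lemma growth_step (h : IsPartitioning s c K' m n si ξ p q) (ht : 2 ≤ t) (hc : 1 ≤ c)
    (hs : 1 < s) {ε L B G A x : ℝ} (hε : 0 < ε) (hL : 1 ≤ L) (hLm : L < m) (hnm : n ≤ m)
    (hB : 1 ≤ B) (hsε : 4 * t * c ≤ s ^ ε) (hG : G = t * c * s ^ K')
    (hmG : 4 * G ≤ (m : ℝ) ^ ε) (hA : 8 * B ≤ A) (k : (i : Fin t) → Fin (ξ i) → ℝ)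
    (hk : ∀ i j, k i j ≤ A * growthBound ((t : ℝ) / (t + 1)) (((t : ℝ) - 1) / (t + 1)) ε L
      (p i j) (q i j))
    (hx : x ≤ B * ((m : ℝ) + n) + ∑ i, ∑ j, k i j) :
    x ≤ A * growthBound ((t : ℝ) / (t + 1)) (((t : ℝ) - 1) / (t + 1)) ε L m n := by
  have ht' : (2 : ℝ) ≤ t := by exact_mod_cast ht
  set α : ℝ := (t : ℝ) / (t + 1) with hα
  have hγ : ((t : ℝ) - 1) / (t + 1) = 2 * α - 1 := by rw [hα]; field_simp; ring
  have hβ : (1 - 1 / (t : ℝ)) * α = 2 * α - 1 := by rw [hα]; field_simp; ring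
  have hα0 : 1 / 2 ≤ α := by rw [hα, div_le_div_iff₀ (by norm_num) (by linarith)]; linarith
  have hα1 : α < 1 := by rw [hα, div_lt_one (by linarith)]; linarith
  rw [hγ] at hk ⊢
  have hs0 : 0 < s := by linarith
  have hL0 : 0 < L := by linarith
  have hm0 : (0 : ℝ) < m := by linarith
  have hn0 : (0 : ℝ) ≤ n := by positivity
  have hnm' : (n : ℝ) ≤ m := by exact_mod_cast hnm
  have hsε0 : 0 < s ^ ε := by positivity
  have hsε' : t * (c * s ^ (-ε)) ≤ 1 / 4 := by
    rw [Real.rpow_neg hs0.le, ← mul_assoc, ← div_eq_mul_inv, div_le_iff₀ hsε0]; linarith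
  have hsε'' : s ^ (-ε) ≤ 1 / 4 := by
    have : (1 : ℝ) ≤ t * c := by nlinarith
    have h0 : 0 < s ^ (-ε) := by positivity
    nlinarith
  have hp : ∀ i, ∑ j, (p i j : ℝ) ≤ m := fun i =>
    (single_le_sum (f := fun i => ∑ j, (p i j : ℝ))
      (fun i _ => by positivity) (mem_univ i)).trans h.sum_p
  have hσ : ∀ i, 0 < si i := fun i => hs0.trans_le (h.le_si i)
  set X : ℝ := (m : ℝ) ^ (α + ε) * (n : ℝ) ^ (α + ε) with hX
  have hX0 : 0 ≤ X := by positivity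
  have mixed : ∑ i, ∑ j, (p i j : ℝ) ^ (α + ε) * (q i j : ℝ) ^ (α + ε) ≤ 1 / 4 * X := by
    have hi : ∀ i, ∑ j, (p i j : ℝ) ^ (α + ε) * (q i j : ℝ) ^ (α + ε)
        ≤ c * s ^ (-ε) * X := fun i => by
      refine (sum_mixed_le univ (fun j => (p i j : ℝ)) (fun j => (q i j : ℝ))
        (fun j => by positivity) (fun j => by positivity) hm0.le hn0 (hσ i) hc hε hα0 hα1 hβ
        (h.p_le i) (fun j => by exact_mod_cast h.q_le i j) (hp i) (h.sum_q i)).trans ?_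
      have : si i ^ (-ε) ≤ s ^ (-ε) :=
        Real.rpow_le_rpow_of_nonpos hs0 (h.le_si i) (by linarith)
      gcongr
    refine (sum_le_sum fun i _ => hi i).trans ?_
    rw [sum_const, card_univ, Fintype.card_fin, nsmul_eq_mul, ← mul_assoc]
    gcongr
  have points : ∑ i, ∑ j, (p i j : ℝ) ^ (1 + ε) ≤ 1 / 4 * (m : ℝ) ^ (1 + ε) := by
    have hi : ∀ i, ∑ j, (p i j : ℝ) ^ (1 + ε) ≤ ((m : ℝ) / s) ^ ε * ∑ j, (p i j : ℝ) :=
      fun i => sum_rpow_one_add_le univ (fun j => (p i j : ℝ)) (fun j => by positivity) hε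
        fun j => (h.p_le i j).trans (div_le_div_of_nonneg_left hm0.le hs0 (h.le_si i))
    calc _ ≤ ((m : ℝ) / s) ^ ε * m := by
          refine (sum_le_sum fun i _ => hi i).trans ?_
          rw [← mul_sum]
          have := h.sum_p
          gcongr
      _ = s ^ (-ε) * (m : ℝ) ^ (1 + ε) := by
          rw [Real.div_rpow hm0.le hs0.le, Real.rpow_neg hs0.le, Real.rpow_add hm0,
            Real.rpow_one]
          ring
      _ ≤ _ := by gcongr
  have ranges : ∑ i, ∑ j, (q i j : ℝ) ^ (1 + ε) ≤ 1 / 4 * (X / L ^ (2 * α - 1)) := by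
    have hi : ∀ i, ∑ j, (q i j : ℝ) ^ (1 + ε) ≤ (n : ℝ) ^ ε * ∑ j, (q i j : ℝ) :=
      fun i => sum_rpow_one_add_le univ (fun j => (q i j : ℝ)) (fun j => by positivity) hε
        fun j => by exact_mod_cast h.q_le i j
    have key : (n : ℝ) ^ (1 - α) * L ^ (2 * α - 1) ≤ (m : ℝ) ^ α := by
      have e : (m : ℝ) ^ α = (m : ℝ) ^ (1 - α) * (m : ℝ) ^ (2 * α - 1) := by
        rw [← Real.rpow_add hm0]; ring_nf
      rw [e]
      have : 0 ≤ 1 - α := by linarith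
      have : 0 ≤ 2 * α - 1 := by linarith
      gcongr
    have en : (n : ℝ) ^ ε * n = (n : ℝ) ^ (α + ε) * (n : ℝ) ^ (1 - α) := by
      have := Real.rpow_add_of_nonneg hn0 hε.le zero_le_one
      rw [Real.rpow_one] at this
      rw [← this, ← Real.rpow_add_of_nonneg hn0 (by linarith) (by linarith)]; ring_nf
    calc _ ≤ (n : ℝ) ^ ε * (G * n) := by
          refine (sum_le_sum fun i _ => hi i).trans ?_
          rw [← mul_sum, hG]
          have := h.sum_q_le (by omega) hc hs
          gcongr
      _ = G * ((n : ℝ) ^ (α + ε) * (n : ℝ) ^ (1 - α)) := by rw [← en]; ring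
      _ ≤ 1 / 4 * (m : ℝ) ^ ε * ((n : ℝ) ^ (α + ε) * (n : ℝ) ^ (1 - α)) := by
          gcongr; linarith
      _ = 1 / 4 * ((m : ℝ) ^ ε * (n : ℝ) ^ (α + ε)
            * ((n : ℝ) ^ (1 - α) * L ^ (2 * α - 1)) / L ^ (2 * α - 1)) := by
          field_simp
      _ ≤ 1 / 4 * ((m : ℝ) ^ ε * (n : ℝ) ^ (α + ε) * (m : ℝ) ^ α / L ^ (2 * α - 1)) := by
          gcongr
      _ = _ := by rw [hX, Real.rpow_add hm0]; ring
  have hA0 : 0 < A := by linarith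
  have total : ∑ i, ∑ j, k i j ≤ A * (1 / 4 * X / L ^ (2 * α - 1)
      + 1 / 4 * (m : ℝ) ^ (1 + ε) + 1 / 4 * (X / L ^ (2 * α - 1))) := by
    refine (sum_le_sum fun i _ => sum_le_sum fun j _ => hk i j).trans ?_
    simp_rw [growthBound, ← mul_sum, sum_add_distrib, ← sum_div]
    gcongr
  have hmm : (m : ℝ) ≤ (m : ℝ) ^ (1 + ε) := by
    simpa using Real.rpow_le_rpow_of_exponent_le (by linarith : (1 : ℝ) ≤ m)
      (by linarith : (1 : ℝ) ≤ 1 + ε)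
  have hY : 0 ≤ X / L ^ (2 * α - 1) := by positivity
  have hnn : 0 ≤ (n : ℝ) ^ (1 + ε) := by positivity
  have hlin : B * ((m : ℝ) + n) ≤ A * (1 / 4 * (m : ℝ) ^ (1 + ε)) := by nlinarith
  calc x ≤ A * (1 / 4 * (m : ℝ) ^ (1 + ε)) + A * (1 / 4 * X / L ^ (2 * α - 1)
      + 1 / 4 * (m : ℝ) ^ (1 + ε) + 1 / 4 * (X / L ^ (2 * α - 1))) := by linarith
    _ = A * (1 / 2 * (X / L ^ (2 * α - 1)) + 1 / 2 * (m : ℝ) ^ (1 + ε)) := by ring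
    _ ≤ _ := by
      unfold growthBound
      rw [← hX]
      exact mul_le_mul_of_nonneg_left (by linarith) hA0.le

end IsPartitioning

/-- The recurrence underlying Lemma 2.3: let `t ≥ 2` be an integer and
`ε > 0`, `c ≥ 1`, `B ≥ 1`, `K' ≥ 1` reals. There is a threshold `s₀ > 0`
(depending on `t, ε, c`) such that for every `s ≥ s₀` there is a constant `A`
(depending only on `t, ε, s, c, B, K'`) such that for every `L ≥ 1` and every
`K : ℕ × ℕ → ℝ≥0` satisfying the base case `K(m,n) ≤ B(m+n)` for `m, n ≤ L`,
the primal recurrence (for `m > L`, `m ≥ n`) and the symmetric dual recurrence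
(for `n > L`, `n ≥ m`) coming from the partitioning theorem of Matoušek and
Patáková, one has, for all `m, n`,
`K(m,n) ≤ A·( m^(t/(t+1)+ε) n^(t/(t+1)+ε) / L^((t-1)/(t+1)) + m^(1+ε) + n^(1+ε) )`. -/
theorem stmt_0 (t : ℕ) (ht : 2 ≤ t) (ε c B K' : ℝ)
    (hε : 0 < ε) (hc : 1 ≤ c) (hB : 1 ≤ B) (hK' : 1 ≤ K') :
    ∃ s₀ : ℝ, 0 < s₀ ∧ ∀ s : ℝ, s₀ ≤ s →
      ∃ A : ℝ, ∀ L : ℝ, 1 ≤ L → ∀ K : ℕ × ℕ → NNReal,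
        -- base case
        (∀ m n : ℕ, (m : ℝ) ≤ L → (n : ℝ) ≤ L →
          (K (m, n) : ℝ) ≤ B * ((m : ℝ) + (n : ℝ))) →
        -- primal recurrence
        (∀ m n : ℕ, L < (m : ℝ) → n ≤ m →
          ∃ (si : Fin t → ℝ) (ξ : Fin t → ℕ)
            (p q : (i : Fin t) → Fin (ξ i) → ℕ),
            (∀ i, s ≤ si i ∧ si i ≤ s ^ K') ∧
            (∀ i, 0 < ξ i) ∧
            (∀ i j, (p i j : ℝ) ≤ (m : ℝ) / si i) ∧
            (∀ i j, q i j ≤ n) ∧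
            (∑ i, ∑ j, (p i j : ℝ)) ≤ (m : ℝ) ∧
            (∀ i, (∑ j, (q i j : ℝ)) ≤
              c * (n : ℝ) * si i ^ (1 - 1 / (t : ℝ))) ∧
            (K (m, n) : ℝ) ≤ B * ((m : ℝ) + (n : ℝ)) +
              ∑ i, ∑ j, (K (p i j, q i j) : ℝ)) →
        -- dual recurrence (roles of the two arguments exchanged)
        (∀ m n : ℕ, L < (n : ℝ) → m ≤ n →
          ∃ (si : Fin t → ℝ) (ξ : Fin t → ℕ)
            (p q : (i : Fin t) → Fin (ξ i) → ℕ),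
            (∀ i, s ≤ si i ∧ si i ≤ s ^ K') ∧
            (∀ i, 0 < ξ i) ∧
            (∀ i j, (p i j : ℝ) ≤ (n : ℝ) / si i) ∧
            (∀ i j, q i j ≤ m) ∧
            (∑ i, ∑ j, (p i j : ℝ)) ≤ (n : ℝ) ∧
            (∀ i, (∑ j, (q i j : ℝ)) ≤
              c * (m : ℝ) * si i ^ (1 - 1 / (t : ℝ))) ∧
            (K (m, n) : ℝ) ≤ B * ((m : ℝ) + (n : ℝ)) +
              ∑ i, ∑ j, (K (q i j, p i j) : ℝ)) →
        -- conclusion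
        ∀ m n : ℕ,
          (K (m, n) : ℝ) ≤ A *
            ((m : ℝ) ^ ((t : ℝ) / ((t : ℝ) + 1) + ε) *
              (n : ℝ) ^ ((t : ℝ) / ((t : ℝ) + 1) + ε) /
              L ^ (((t : ℝ) - 1) / ((t : ℝ) + 1)) +
            (m : ℝ) ^ (1 + ε) + (n : ℝ) ^ (1 + ε)) := by
  have ht' : (2 : ℝ) ≤ t := by exact_mod_cast ht
  have htc : 2 ≤ t * c := by nlinarith
  refine ⟨(4 * t * c) ^ (1 / ε), by positivity, fun s hs => ?_⟩
  have hs1 : 1 < s := (Real.one_lt_rpow (by linarith) (by positivity)).trans_le hs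
  have hsε : 4 * t * c ≤ s ^ ε := by
    have := Real.rpow_le_rpow (by positivity) hs hε.le
    rwa [← Real.rpow_mul (by positivity), one_div_mul_cancel hε.ne', Real.rpow_one] at this
  set G : ℝ := t * c * s ^ K' with hG
  have hG1 : 1 ≤ G := by
    have : 1 ≤ s ^ K' := Real.one_le_rpow hs1.le (by linarith)
    nlinarith
  set D : ℝ := B + G with hD
  have hD1 : 1 ≤ D := by linarith
  set M : ℝ := (4 * G) ^ (1 / ε) with hM
  have hDM : 0 < D ^ (2 * M) := by positivity
  refine ⟨8 * B + D ^ (2 * M), fun L hL K base primal dual => ?_⟩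
  have primal' : ∀ m n : ℕ, L < (m : ℝ) → n ≤ m →
      ∃ (si : Fin t → ℝ) (ξ : Fin t → ℕ) (p q : (i : Fin t) → Fin (ξ i) → ℕ),
        IsPartitioning s c K' m n si ξ p q ∧
        (K (m, n) : ℝ) ≤ B * ((m : ℝ) + n) + ∑ i, ∑ j, (K (p i j, q i j) : ℝ) := by
    intro m n h1 h2
    obtain ⟨si, ξ, p, q, a1, -, a3, a4, a5, a6, a7⟩ := primal m n h1 h2
    exact ⟨si, ξ, p, q, ⟨fun i => (a1 i).1, fun i => (a1 i).2, a3, a4, a5, a6⟩, a7⟩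
  have dual' : ∀ m n : ℕ, L < (n : ℝ) → m ≤ n →
      ∃ (si : Fin t → ℝ) (ξ : Fin t → ℕ) (p q : (i : Fin t) → Fin (ξ i) → ℕ),
        IsPartitioning s c K' n m si ξ p q ∧
        (K (m, n) : ℝ) ≤ B * ((n : ℝ) + m) + ∑ i, ∑ j, (K (q i j, p i j) : ℝ) := by
    intro m n h1 h2
    obtain ⟨si, ξ, p, q, a1, -, a3, a4, a5, a6, a7⟩ := dual m n h1 h2
    exact ⟨si, ξ, p, q, ⟨fun i => (a1 i).1, fun i => (a1 i).2, a3, a4, a5, a6⟩,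
      by rwa [add_comm (n : ℝ)]⟩
  have pos_of_lt : ∀ k : ℕ, L < k → 0 < k := fun k hk => by
    have : (0 : ℝ) < k := by linarith
    exact_mod_cast this
  have trichotomy : ∀ m n : ℕ, ((m : ℝ) ≤ L ∧ (n : ℝ) ≤ L) ∨ (L < m ∧ n ≤ m) ∨ (L < n ∧ m ≤ n) := by
    intro m n
    rcases le_total n m with h | h
    · have : (n : ℝ) ≤ m := by exact_mod_cast h
      rcases le_or_gt (m : ℝ) L with h' | h'
      · exact Or.inl ⟨h', this.trans h'⟩
      · exact Or.inr (Or.inl ⟨h', h⟩)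
    · have : (m : ℝ) ≤ n := by exact_mod_cast h
      rcases le_or_gt (n : ℝ) L with h' | h'
      · exact Or.inl ⟨this.trans h', h'⟩
      · exact Or.inr (Or.inr ⟨h', h⟩)
  have crude : ∀ N m n : ℕ, m + n = N →
      (K (m, n) : ℝ) ≤ D ^ (m + n) * ((m : ℝ) + n) := by
    intro N
    induction N using Nat.strong_induction_on with
    | _ N ih =>
      intro m n hN
      rcases trichotomy m n with ⟨h1, h2⟩ | ⟨h1, h2⟩ | ⟨h1, h2⟩
      · refine (base m n h1 h2).trans ?_
        rcases Nat.eq_zero_or_pos (m + n) with h0 | h0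
        · obtain ⟨rfl, rfl⟩ : m = 0 ∧ n = 0 := by omega
          simp
        · have : D ≤ D ^ (m + n) := le_self_pow₀ hD1 (by omega)
          gcongr
          linarith
      · obtain ⟨si, ξ, p, q, hP, hx⟩ := primal' m n h1 h2
        exact hP.crude_step (by omega) hc hs1 (pos_of_lt m h1) hB hG hG1 hD _
          (fun i j => ih _ (hN ▸ hP.add_lt hs1 (pos_of_lt m h1) i j) _ _ rfl) hx
      · obtain ⟨si, ξ, p, q, hP, hx⟩ := dual' m n h1 h2
        rw [add_comm m n, add_comm (m : ℝ)]
        refine hP.crude_step (by omega) hc hs1 (pos_of_lt n h1) hB hG hG1 hD _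
          (fun i j => ?_) hx
        have hlt := hP.add_lt hs1 (pos_of_lt n h1) i j
        have := ih (q i j + p i j) (by omega) _ _ rfl
        rwa [add_comm (q i j), add_comm (q i j : ℝ)] at this
  have small : ∀ m n : ℕ, (m : ℝ) ≤ M → (n : ℝ) ≤ M →
      (K (m, n) : ℝ) ≤ (8 * B + D ^ (2 * M)) *
        growthBound ((t : ℝ) / (t + 1)) (((t : ℝ) - 1) / (t + 1)) ε L m n := by
    intro m n hm hn
    have h1 : D ^ (m + n) ≤ D ^ (2 * M) := by
      rw [← Real.rpow_natCast]
      refine Real.rpow_le_rpow_of_exponent_le hD1 ?_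
      push_cast
      linarith
    refine (crude _ m n rfl).trans ?_
    have h2 := add_le_growthBound (α := (t : ℝ) / (t + 1)) (γ := ((t : ℝ) - 1) / (t + 1))
      hε hL m n
    exact mul_le_mul (by linarith) h2 (by positivity) (by linarith)
  have large : ∀ k : ℕ, ¬ (k : ℝ) ≤ M → 4 * G ≤ (k : ℝ) ^ ε := fun k hk => by
    have := Real.rpow_le_rpow (by positivity) (not_le.mp hk).le hε.le
    rwa [hM, ← Real.rpow_mul (by positivity), one_div_mul_cancel hε.ne', Real.rpow_one] at this
  suffices main : ∀ N m n : ℕ, m + n = N → (K (m, n) : ℝ) ≤ (8 * B + D ^ (2 * M)) *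
      growthBound ((t : ℝ) / (t + 1)) (((t : ℝ) - 1) / (t + 1)) ε L m n from
    fun m n => main _ m n rfl
  intro N
  induction N using Nat.strong_induction_on with
  | _ N ih =>
    intro m n hN
    rcases trichotomy m n with ⟨h1, h2⟩ | ⟨h1, h2⟩ | ⟨h1, h2⟩
    · exact (base m n h1 h2).trans
        (mul_le_mul (by linarith) (add_le_growthBound hε hL m n) (by positivity) (by linarith))
    · have h2' : (n : ℝ) ≤ m := by exact_mod_cast h2
      by_cases hmM : (m : ℝ) ≤ M
      · exact small m n hmM (h2'.trans hmM)
      obtain ⟨si, ξ, p, q, hP, hx⟩ := primal' m n h1 h2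
      exact hP.growth_step ht hc hs1 hε hL h1 h2 hB hsε hG (large m hmM) (by linarith) _
        (fun i j => ih _ (hN ▸ hP.add_lt hs1 (pos_of_lt m h1) i j) _ _ rfl) hx
    · have h2' : (m : ℝ) ≤ n := by exact_mod_cast h2
      by_cases hnM : (n : ℝ) ≤ M
      · exact small m n (h2'.trans hnM) hnM
      obtain ⟨si, ξ, p, q, hP, hx⟩ := dual' m n h1 h2
      rw [growthBound_comm]
      refine hP.growth_step ht hc hs1 hε hL h1 h2 hB hsε hG (large n hnM) (by linarith) _
        (fun i j => ?_) hx
      have hlt := hP.add_lt hs1 (pos_of_lt n h1) i j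
      rw [growthBound_comm]
      exact ih (q i j + p i j) (by omega) _ _ rfl
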